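/- arXiv:math/0105020 — 6 statements merged into one kernel-verified Lean document; each statement's English description precedes it below -/
import Mathlib

section
/- In the ring R the following identities hold: (1 + t_1)·e = 0; t_1 − 1 lies in the principal ideal eR (indeed t_1 = 1 + e(s_{11} + t_2)); and t_1² = 1. -/
open MvPolynomial

/-- Generators of the ring `R`: symbols `s i j` and `t k`. -/
inductive Gen : Type
  | s : ℕ → ℕ → Gen
  | t : ℕ → Gen

/-- The defining relations of the ring `R`:
`t₀ = 0`, `s₁₀ = 1`, `sᵢ₀ = 0` for `i > 1`, `tₖ - s₀ₖ = s₀₀ t₍ₖ₊₁₎`,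
and `sⱼₖ - aⱼₖ = s₀₀ s₍ⱼ₊₁₎ₖ`. -/
def rels (L : Type) [CommRing L] (a : ℕ → ℕ → L) : Set (MvPolynomial Gen L) :=
  {X (Gen.t 0)} ∪ {X (Gen.s 1 0) - 1} ∪
  {p | ∃ i, 1 < i ∧ p = X (Gen.s i 0)} ∪
  {p | ∃ k, p = X (Gen.t k) - X (Gen.s 0 k) - X (Gen.s 0 0) * X (Gen.t (k + 1))} ∪
  {p | ∃ j k, p = X (Gen.s j k) - C (a j k) - X (Gen.s 0 0) * X (Gen.s (j + 1) k)}

/-- The ring `R`: the commutative `L`-algebra with generators `s i j`, `t k`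
and the relations above. -/
abbrev Rring (L : Type) [CommRing L] (a : ℕ → ℕ → L) : Type :=
  MvPolynomial Gen L ⧸ Ideal.span (rels L a)

variable {L : Type} [CommRing L]

/-- The image of the generator `s i j` in `R`. -/
noncomputable def sR (a : ℕ → ℕ → L) (i j : ℕ) : Rring L a :=
  Ideal.Quotient.mk _ (X (Gen.s i j))

/-- The image of the generator `t k` in `R`. -/
noncomputable def tR (a : ℕ → ℕ → L) (k : ℕ) : Rring L a :=
  Ideal.Quotient.mk _ (X (Gen.t k))

/-- `b k := s 0 k`. -/
noncomputable def bR (a : ℕ → ℕ → L) (k : ℕ) : Rring L a := sR a 0 k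

/-- `e := b 0 = s 0 0`. -/
noncomputable def eR (a : ℕ → ℕ → L) : Rring L a := sR a 0 0

/-- In `R` we have `(1 + t₁) e = 0`, `t₁ = 1 + e (s₁₁ + t₂)`
(so `t₁ - 1 ∈ eR`), and `t₁² = 1`. -/
theorem stmt1 (a : ℕ → ℕ → L) (hsym : ∀ i j, a i j = a j i)
    (h01 : a 0 1 = 1) (h0 : ∀ i, i ≠ 1 → a 0 i = 0) :
    (1 + tR a 1) * eR a = 0 ∧
    tR a 1 = 1 + eR a * (sR a 1 1 + tR a 2) ∧
    tR a 1 - 1 ∈ Ideal.span {eR a} ∧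
    (tR a 1) ^ 2 = 1 := by
  have ht0 : tR a 0 = 0 :=
    Ideal.Quotient.eq_zero_iff_mem.2 (Ideal.subset_span (by simp [rels]))
  have ht (k : ℕ) : tR a k - sR a 0 k - eR a * tR a (k + 1) = 0 :=
    Ideal.Quotient.eq_zero_iff_mem.2 (Ideal.subset_span (Or.inl (Or.inr ⟨k, rfl⟩)))
  have hs : sR a 0 1 - 1 - eR a * sR a 1 1 = 0 := by
    have h : sR a 0 1 - Ideal.Quotient.mk _ (C (a 0 1)) - eR a * sR a 1 1 = 0 :=
      Ideal.Quotient.eq_zero_iff_mem.2 (Ideal.subset_span (Or.inr ⟨0, 1, rfl⟩))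
    rwa [h01, C_1, map_one] at h
  have he : (1 + tR a 1) * eR a = 0 := by
    have h : tR a 0 - eR a - eR a * tR a 1 = 0 := ht 0
    linear_combination ht0 - h
  have h1 : tR a 1 = 1 + eR a * (sR a 1 1 + tR a 2) := by
    linear_combination ht 1 + hs
  refine ⟨he, h1, Ideal.mem_span_singleton'.2 ⟨sR a 1 1 + tR a 2, ?_⟩, ?_⟩
  · linear_combination -h1
  · linear_combination (1 + tR a 1) * h1 + (sR a 1 1 + tR a 2) * he
end

section
/- There is a well-defined L-algebra homomorphism ε: R → L with ε(s_{ij}) = a_{ij}, ε(t_k) = δ_{1k}, ε(b_k) = δ_{1k}, and ε(e) = 0, and ε induces a ring isomorphism R/eR ≅ L. -/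
open MvPolynomial

variable {L : Type} [CommRing L]

/-- The values of the augmentation on the generators of `R`. -/
def augVal (a : ℕ → ℕ → L) : Gen → L
  | Gen.s i j => a i j
  | Gen.t k => if k = 1 then 1 else 0

theorem aeval_augVal_eq_zero (a : ℕ → ℕ → L) (hsym : ∀ i j, a i j = a j i)
    (h01 : a 0 1 = 1) (h0 : ∀ i, i ≠ 1 → a 0 i = 0) {p : MvPolynomial Gen L}
    (hp : p ∈ Ideal.span (rels L a)) : aeval (augVal a) p = 0 := by
  have h00 : a 0 0 = 0 := h0 0 (by omega)
  suffices h : Ideal.span (rels L a) ≤ RingHom.ker (aeval (augVal a)) from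
    RingHom.mem_ker.mp (h hp)
  rw [Ideal.span_le]
  rintro p ((((rfl | rfl) | ⟨i, hi, rfl⟩) | ⟨k, rfl⟩) | ⟨j, k, rfl⟩) <;>
    rw [SetLike.mem_coe, RingHom.mem_ker]
  · simp [augVal]
  · simp [augVal, hsym 1 0, h01]
  · simp [augVal, hsym i 0, h0 i (by omega)]
  · by_cases hk : k = 1
    · simp [augVal, hk, h00, h01]
    · simp [augVal, hk, h00, h0 k hk]
  · simp [augVal, h00]

/-- The augmentation `R → L`. -/
noncomputable def aug (a : ℕ → ℕ → L) (hsym : ∀ i j, a i j = a j i)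
    (h01 : a 0 1 = 1) (h0 : ∀ i, i ≠ 1 → a 0 i = 0) : Rring L a →ₐ[L] L :=
  Ideal.Quotient.liftₐ _ (aeval (augVal a)) fun _ => aeval_augVal_eq_zero a hsym h01 h0

theorem sR_sub_algebraMap (a : ℕ → ℕ → L) (j k : ℕ) :
    sR a j k - algebraMap L (Rring L a) (a j k) = eR a * sR a (j + 1) k := by
  rw [← sub_eq_zero]
  exact Ideal.Quotient.eq_zero_iff_mem.mpr (Ideal.subset_span (Or.inr ⟨j, k, rfl⟩))

theorem tR_sub_sR (a : ℕ → ℕ → L) (k : ℕ) :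
    tR a k - sR a 0 k = eR a * tR a (k + 1) := by
  rw [← sub_eq_zero]
  exact Ideal.Quotient.eq_zero_iff_mem.mpr (Ideal.subset_span (Or.inl (Or.inr ⟨k, rfl⟩)))

/-- Modulo `e`, every element of `R` is congruent to its augmentation. -/
theorem sub_algebraMap_aug_mem (a : ℕ → ℕ → L) (hsym : ∀ i j, a i j = a j i)
    (h01 : a 0 1 = 1) (h0 : ∀ i, i ≠ 1 → a 0 i = 0) (x : Rring L a) :
    x - algebraMap L (Rring L a) (aug a hsym h01 h0 x) ∈ Ideal.span {eR a} := by
  have hs (j k : ℕ) : sR a j k - algebraMap L (Rring L a) (a j k) ∈ Ideal.span {eR a} :=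
    Ideal.mem_span_singleton.mpr ⟨_, sR_sub_algebraMap a j k⟩
  have ht (k : ℕ) : tR a k - algebraMap L (Rring L a) (if k = 1 then 1 else 0) ∈
      Ideal.span {eR a} := by
    have hk : a 0 k = if k = 1 then 1 else 0 := by
      split_ifs with hk
      · rw [hk, h01]
      · exact h0 k hk
    rw [← hk, ← sub_add_sub_cancel _ (sR a 0 k)]
    exact add_mem (Ideal.mem_span_singleton.mpr ⟨_, tR_sub_sR a k⟩) (hs 0 k)
  obtain ⟨p, rfl⟩ := Ideal.Quotient.mk_surjective x
  change Ideal.Quotient.mk _ p - algebraMap L (Rring L a) (aeval (augVal a) p) ∈ _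
  rw [← Ideal.Quotient.mk_eq_mk_iff_sub_mem]
  have key : (Ideal.Quotient.mkₐ L (Ideal.span {eR a})).comp
      (Ideal.Quotient.mkₐ L (Ideal.span (rels L a))) =
      (Algebra.ofId L (Rring L a ⧸ Ideal.span {eR a})).comp (aeval (augVal a)) := by
    ext g
    rw [AlgHom.comp_apply, AlgHom.comp_apply, aeval_X]
    refine (Ideal.Quotient.mk_eq_mk_iff_sub_mem _ _).mpr ?_
    cases g with
    | s i j => exact hs i j
    | t k => exact ht k
  exact DFunLike.congr_fun key p

/-- There is an `L`-algebra homomorphism `ε : R → L` with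
`ε(sᵢⱼ) = aᵢⱼ`, `ε(tₖ) = δ₁ₖ` (hence `ε(bₖ) = δ₁ₖ`), `ε(e) = 0`, which is
surjective with kernel exactly `eR`, i.e. it induces an isomorphism `R/eR ≅ L`. -/
theorem stmt2 (a : ℕ → ℕ → L) (hsym : ∀ i j, a i j = a j i)
    (h01 : a 0 1 = 1) (h0 : ∀ i, i ≠ 1 → a 0 i = 0) :
    ∃ ε : Rring L a →ₐ[L] L,
      (∀ i j, ε (sR a i j) = a i j) ∧
      (∀ k, ε (tR a k) = if k = 1 then 1 else 0) ∧
      (∀ k, ε (bR a k) = if k = 1 then 1 else 0) ∧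
      ε (eR a) = 0 ∧
      Function.Surjective ε ∧
      RingHom.ker (ε : Rring L a →+* L) = Ideal.span {eR a} := by
  have hs (i j : ℕ) : aug a hsym h01 h0 (sR a i j) = a i j := aeval_X (augVal a) (Gen.s i j)
  have he : aug a hsym h01 h0 (eR a) = 0 := (hs 0 0).trans (h0 0 (by omega))
  refine ⟨aug a hsym h01 h0, hs, fun k => aeval_X (augVal a) (Gen.t k), fun k => ?_, he,
    fun x => ⟨algebraMap L _ x, AlgHom.commutes _ x⟩, le_antisymm (fun x hx => ?_) ?_⟩
  · rw [bR, hs]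
    split_ifs with hk
    · rw [hk, h01]
    · exact h0 k hk
  · have hx' : aug a hsym h01 h0 x = 0 := hx
    simpa [hx'] using sub_algebraMap_aug_mem a hsym h01 h0 x
  · rw [Ideal.span_singleton_le_iff_mem]
    exact he
end

section
/- There is a well-defined L-algebra homomorphism θ: R → R' determined by θ(s_{ij}) = b_j b_0^{−i} − Σ_{l=1}^{i} a_{i−l,j} b_0^{−l} and θ(t_k) = − Σ_{l=1}^{k} b_{k−l} b_0^{−l}; that is, these assignments respect all the defining relations of R (in particular θ(s_{0j}) = b_j, so the notation is self-consistent, and θ(e) = b_0). -/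
open MvPolynomial

variable {L : Type} [CommRing L]

/-- `R' := L[b₀, b₁, b₂, …][b₀⁻¹]`, the localization of the polynomial algebra
on countably many variables `bᵢ` (the variable `X i` standing for `bᵢ`) away
from `b₀`. -/
abbrev Rprime (L : Type) [CommRing L] : Type :=
  Localization.Away (X 0 : MvPolynomial ℕ L)

/-- The image of `bᵢ` in `R'`. -/
noncomputable def bP (L : Type) [CommRing L] (i : ℕ) : Rprime L :=
  algebraMap (MvPolynomial ℕ L) (Rprime L) (X i)

/-- `b₀⁻¹` in `R'`. -/
noncomputable def b0inv (L : Type) [CommRing L] : Rprime L :=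
  IsLocalization.Away.invSelf (X 0 : MvPolynomial ℕ L)

/-- `b_j b₀⁻ⁱ - Σ_{l=1}^{i} a_{i-l,j} b₀⁻ˡ`, the intended value `θ(sᵢⱼ)`. -/
noncomputable def thetaS (a : ℕ → ℕ → L) (i j : ℕ) : Rprime L :=
  bP L j * b0inv L ^ i -
    ∑ l ∈ Finset.Icc 1 i, algebraMap L (Rprime L) (a (i - l) j) * b0inv L ^ l

/-- `-Σ_{l=1}^{k} b_{k-l} b₀⁻ˡ`, the intended value `θ(tₖ)`. -/
noncomputable def thetaT (a : ℕ → ℕ → L) (k : ℕ) : Rprime L :=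
  -∑ l ∈ Finset.Icc 1 k, bP L (k - l) * b0inv L ^ l

theorem sum_Icc_one_mul_pow_succ {A : Type*} [CommSemiring A] (c : ℕ → A) (u : A) (k : ℕ) :
    ∑ l ∈ Finset.Icc 1 (k + 1), c (k + 1 - l) * u ^ l =
      u * (c k + ∑ l ∈ Finset.Icc 1 k, c (k - l) * u ^ l) := by
  have key (n : ℕ) (f : ℕ → A) : ∑ l ∈ Finset.Icc 1 n, f l = ∑ l ∈ Finset.range n, f (l + 1) := by
    induction n with
    | zero => simp
    | succ n ih => rw [Finset.sum_Icc_succ_top (by omega), ih, Finset.sum_range_succ]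
  rw [key, key, Finset.sum_range_succ', mul_add, Finset.mul_sum, add_comm]
  congr 1
  · simp [mul_comm]
  · refine Finset.sum_congr rfl fun l _ => ?_
    rw [Nat.add_sub_add_right, pow_succ _ (l + 1)]
    ring

theorem bP_zero_mul_b0inv : bP L 0 * b0inv L = 1 :=
  IsLocalization.Away.mul_invSelf (X 0 : MvPolynomial ℕ L)

theorem thetaS_zero_left (a : ℕ → ℕ → L) (j : ℕ) : thetaS a 0 j = bP L j := by
  simp [thetaS]

theorem thetaT_zero (a : ℕ → ℕ → L) : thetaT a 0 = 0 := by
  simp [thetaT]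

theorem thetaS_succ (a : ℕ → ℕ → L) (i j : ℕ) :
    thetaS a (i + 1) j = b0inv L * (thetaS a i j - algebraMap L (Rprime L) (a i j)) := by
  simp only [thetaS]
  rw [sum_Icc_one_mul_pow_succ (fun n => algebraMap L (Rprime L) (a n j))]
  ring

theorem thetaT_succ (a : ℕ → ℕ → L) (k : ℕ) :
    thetaT a (k + 1) = b0inv L * (thetaT a k - bP L k) := by
  simp only [thetaT]
  rw [sum_Icc_one_mul_pow_succ (bP L)]
  ring

theorem thetaS_one_zero (a : ℕ → ℕ → L) (h00 : a 0 0 = 0) : thetaS a 1 0 = 1 := by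
  rw [thetaS_succ, thetaS_zero_left, h00, map_zero, sub_zero, mul_comm, bP_zero_mul_b0inv]

theorem thetaS_add_two_zero (a : ℕ → ℕ → L) (h00 : a 0 0 = 0) (h10 : a 1 0 = 1)
    (h : ∀ i, 1 < i → a i 0 = 0) (i : ℕ) : thetaS a (i + 2) 0 = 0 := by
  induction i with
  | zero => rw [thetaS_succ, thetaS_one_zero a h00, h10, map_one, sub_self, mul_zero]
  | succ i ih => rw [thetaS_succ, ih, h _ (by omega), map_zero, sub_self, mul_zero]

/-- The intended values of `θ` on the generators of `R`. -/
noncomputable def thetaGen (a : ℕ → ℕ → L) : Gen → Rprime L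
  | Gen.s i j => thetaS a i j
  | Gen.t k => thetaT a k

theorem aeval_thetaGen_eq_zero_of_mem_rels (a : ℕ → ℕ → L) (h00 : a 0 0 = 0) (h10 : a 1 0 = 1)
    (h : ∀ i, 1 < i → a i 0 = 0) {p : MvPolynomial Gen L} (hp : p ∈ rels L a) :
    aeval (thetaGen a) p = 0 := by
  rcases hp with (((rfl | rfl) | ⟨i, hi, rfl⟩) | ⟨k, rfl⟩) | ⟨j, k, rfl⟩
  · simp only [aeval_X, thetaGen, thetaT_zero]
  · simp only [map_sub, map_one, aeval_X, thetaGen, thetaS_one_zero a h00, sub_self]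
  · obtain ⟨i, rfl⟩ := Nat.exists_eq_add_of_le' hi
    simpa only [aeval_X, thetaGen] using thetaS_add_two_zero a h00 h10 h i
  · simp only [map_sub, map_mul, aeval_X, thetaGen, thetaS_zero_left, thetaT_succ]
    linear_combination (bP L k - thetaT a k) * bP_zero_mul_b0inv (L := L)
  · simp only [map_sub, map_mul, aeval_X, aeval_C, thetaGen, thetaS_zero_left, thetaS_succ]
    linear_combination
      (algebraMap L (Rprime L) (a j k) - thetaS a j k) * bP_zero_mul_b0inv (L := L)

/-- There is a well-defined `L`-algebra homomorphism `θ : R → R'`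
with `θ(sᵢⱼ) = b_j b₀⁻ⁱ - Σ_{l=1}^{i} a_{i-l,j} b₀⁻ˡ` and
`θ(tₖ) = -Σ_{l=1}^{k} b_{k-l} b₀⁻ˡ`; in particular `θ(s₀ⱼ) = bⱼ` and
`θ(e) = b₀`. -/
theorem stmt7 (a : ℕ → ℕ → L) (hsym : ∀ i j, a i j = a j i)
    (h01 : a 0 1 = 1) (h0 : ∀ i, i ≠ 1 → a 0 i = 0) :
    ∃ θ : Rring L a →ₐ[L] Rprime L,
      (∀ i j, θ (sR a i j) = thetaS a i j) ∧
      (∀ k, θ (tR a k) = thetaT a k) ∧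
      (∀ j, θ (bR a j) = bP L j) ∧
      θ (eR a) = bP L 0 := by
  have h00 : a 0 0 = 0 := h0 0 zero_ne_one
  have h10 : a 1 0 = 1 := (hsym 1 0).trans h01
  have hi0 (i : ℕ) (hi : 1 < i) : a i 0 = 0 := (hsym i 0).trans (h0 i hi.ne')
  have hker : Ideal.span (rels L a) ≤ RingHom.ker (aeval (thetaGen a)) :=
    Ideal.span_le.2 fun p hp => aeval_thetaGen_eq_zero_of_mem_rels a h00 h10 hi0 hp
  let θ : Rring L a →ₐ[L] Rprime L :=
    Ideal.Quotient.liftₐ _ (aeval (thetaGen a)) fun p hp => hker hp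
  have hs (i j : ℕ) : θ (sR a i j) = thetaS a i j := aeval_X (thetaGen a) (Gen.s i j)
  have ht (k : ℕ) : θ (tR a k) = thetaT a k := aeval_X (thetaGen a) (Gen.t k)
  exact ⟨θ, hs, ht, fun j => (hs 0 j).trans (thetaS_zero_left a j),
    (hs 0 0).trans (thetaS_zero_left a 0)⟩
end

section
/- The homomorphism θ: R → R' sends e to the invertible element b_0, hence induces an L-algebra map R[1/e] → R', and this induced map is an isomorphism. Its inverse is the L-algebra map σ: R' → R[1/e] determined by σ(b_i) = b_i/1; in particular σ is surjective and θ∘σ = id. -/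
open MvPolynomial

variable {L : Type} [CommRing L]

theorem eR_mul_sR_succ (a : ℕ → ℕ → L) (j k : ℕ) :
    eR a * sR a (j + 1) k = sR a j k - algebraMap L (Rring L a) (a j k) := by
  have h : (Ideal.Quotient.mk (Ideal.span (rels L a)))
      (X (Gen.s j k) - C (a j k) - X (Gen.s 0 0) * X (Gen.s (j + 1) k)) = 0 :=
    Ideal.Quotient.eq_zero_iff_mem.mpr (Ideal.subset_span (Or.inr ⟨j, k, rfl⟩))
  rw [map_sub, map_sub, map_mul] at h
  exact (sub_eq_zero.mp h).symm

theorem eR_mul_tR_succ (a : ℕ → ℕ → L) (k : ℕ) :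
    eR a * tR a (k + 1) = tR a k - bR a k := by
  have h : (Ideal.Quotient.mk (Ideal.span (rels L a)))
      (X (Gen.t k) - X (Gen.s 0 k) - X (Gen.s 0 0) * X (Gen.t (k + 1))) = 0 :=
    Ideal.Quotient.eq_zero_iff_mem.mpr (Ideal.subset_span (Or.inl (Or.inr ⟨k, rfl⟩)))
  rw [map_sub, map_sub, map_mul] at h
  exact (sub_eq_zero.mp h).symm

theorem tR_zero (a : ℕ → ℕ → L) : tR a 0 = 0 :=
  Ideal.Quotient.eq_zero_iff_mem.mpr
    (Ideal.subset_span (Or.inl (Or.inl (Or.inl (Or.inl rfl)))))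

/-- Two `L`-algebra maps out of `R` that invert `e` and agree on all `bⱼ` are equal. -/
theorem Rring_algHom_ext {a : ℕ → ℕ → L} {A : Type*} [CommRing A] [Algebra L A]
    {f g : Rring L a →ₐ[L] A} (he : IsUnit (g (eR a)))
    (hb : ∀ j, f (bR a j) = g (bR a j)) : f = g := by
  have hfe : f (eR a) = g (eR a) := hb 0
  have hs : ∀ i j, f (sR a i j) = g (sR a i j) := by
    intro i j
    induction i with
    | zero => exact hb j
    | succ i ih =>
      apply he.mul_left_cancel
      rw [← map_mul, ← hfe, ← map_mul, eR_mul_sR_succ, map_sub, map_sub, ih,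
        AlgHom.commutes, AlgHom.commutes]
  have ht : ∀ k, f (tR a k) = g (tR a k) := by
    intro k
    induction k with
    | zero => rw [tR_zero, map_zero, map_zero]
    | succ k ih =>
      apply he.mul_left_cancel
      rw [← map_mul, ← hfe, ← map_mul, eR_mul_tR_succ, map_sub, map_sub, ih, hb]
  apply Ideal.Quotient.algHom_ext
  apply MvPolynomial.algHom_ext
  rintro (⟨i, j⟩ | k)
  · exact hs i j
  · exact ht k

theorem isUnit_bP_zero (L : Type) [CommRing L] : IsUnit (bP L 0) :=
  IsLocalization.Away.algebraMap_isUnit (X 0 : MvPolynomial ℕ L)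

/-- An algebra map out of a localization away from `x` extending a map that inverts `x`. -/
theorem exists_algHom_away {A B : Type} [CommRing A] [Algebra L A] [CommRing B] [Algebra L B]
    (x : A) (f : A →ₐ[L] B) (hx : IsUnit (f x)) :
    ∃ g : Localization.Away x →ₐ[L] B,
      g.comp (IsScalarTower.toAlgHom L A (Localization.Away x)) = f := by
  have h : ∀ y : Submonoid.powers x, IsUnit (f y) := by
    rintro ⟨_, n, rfl⟩
    simpa using hx.pow n
  refine ⟨IsLocalization.liftAlgHom h, ?_⟩
  ext y
  simp

theorem away_algHom_ext {A B : Type} [CommRing A] [Algebra L A] [CommRing B] [Algebra L B]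
    (x : A) {f g : Localization.Away x →ₐ[L] B}
    (h : f.comp (IsScalarTower.toAlgHom L A (Localization.Away x)) =
      g.comp (IsScalarTower.toAlgHom L A (Localization.Away x))) : f = g :=
  IsLocalization.algHom_ext (Submonoid.powers x) h

/-- `θ(e) = b₀` is invertible, so `θ` induces an `L`-algebra map
`θ' : R[1/e] → R'`, which is an isomorphism with inverse the `L`-algebra map
`σ : R' → R[1/e]` determined by `σ(bᵢ) = bᵢ/1`; in particular `σ` is
surjective and `θ' ∘ σ = id`. -/
theorem stmt8 (a : ℕ → ℕ → L) (hsym : ∀ i j, a i j = a j i)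
    (h01 : a 0 1 = 1) (h0 : ∀ i, i ≠ 1 → a 0 i = 0)
    (θ : Rring L a →ₐ[L] Rprime L)
    (hθs : ∀ i j, θ (sR a i j) = thetaS a i j)
    (hθt : ∀ k, θ (tR a k) = thetaT a k) :
    IsUnit (θ (eR a)) ∧
    ∃ θ' : Localization.Away (eR a) →ₐ[L] Rprime L,
      θ'.comp (IsScalarTower.toAlgHom L (Rring L a) (Localization.Away (eR a))) = θ ∧
      Function.Bijective θ' ∧
      ∃ σ : Rprime L →ₐ[L] Localization.Away (eR a),
        (∀ i, σ (bP L i) = algebraMap (Rring L a) (Localization.Away (eR a)) (bR a i)) ∧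
        Function.Surjective σ ∧
        θ'.comp σ = AlgHom.id L (Rprime L) ∧
        σ.comp θ' = AlgHom.id L (Localization.Away (eR a)) := by
  have hθb : ∀ j, θ (bR a j) = bP L j := fun j => by
    simpa [bR, thetaS] using hθs 0 j
  have hunit : IsUnit (θ (eR a)) := by
    have h : θ (eR a) = bP L 0 := hθb 0
    rw [h]
    exact isUnit_bP_zero L
  have heunit : IsUnit (algebraMap (Rring L a) (Localization.Away (eR a)) (eR a)) :=
    IsLocalization.Away.algebraMap_isUnit (eR a)
  obtain ⟨θ', hθ'⟩ := exists_algHom_away (eR a) θ hunit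
  have hθ'R : ∀ y, θ' (algebraMap (Rring L a) (Localization.Away (eR a)) y) = θ y :=
    fun y => DFunLike.congr_fun hθ' y
  obtain ⟨σ, hσ⟩ := exists_algHom_away (X 0 : MvPolynomial ℕ L)
    (aeval fun i => algebraMap (Rring L a) (Localization.Away (eR a)) (bR a i))
    (by rw [aeval_X]; exact heunit)
  have hσb : ∀ i, σ (bP L i) = algebraMap (Rring L a) (Localization.Away (eR a)) (bR a i) :=
    fun i => (DFunLike.congr_fun hσ (X i)).trans (aeval_X _ i)
  have hθσ : θ'.comp σ = AlgHom.id L (Rprime L) := by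
    apply away_algHom_ext
    apply MvPolynomial.algHom_ext
    intro i
    change θ' (σ (bP L i)) = bP L i
    rw [hσb, hθ'R, hθb]
  have hσθ : σ.comp θ' = AlgHom.id L (Localization.Away (eR a)) := by
    apply away_algHom_ext
    apply Rring_algHom_ext
    · exact heunit
    · intro j
      change σ (θ' (algebraMap (Rring L a) (Localization.Away (eR a)) (bR a j))) =
        algebraMap (Rring L a) (Localization.Away (eR a)) (bR a j)
      rw [hθ'R, hθb, hσb]
  have hleft : Function.LeftInverse σ θ' := DFunLike.congr_fun hσθ
  have hright : Function.RightInverse σ θ' := DFunLike.congr_fun hθσ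
  exact ⟨hunit, θ', hθ', ⟨hleft.injective, hright.surjective⟩, σ, hσb, hleft.surjective,
    hθσ, hσθ⟩
end

section
/- Assume in addition that 2 is a nonzerodivisor in L. Then the image of e is a nonzerodivisor in the quotient ring R̄ := R/(1 + t_1), where (1 + t_1) is the principal ideal of R generated by 1 + t_1. -/
open MvPolynomial

variable {L : Type} [CommRing L]

theorem Ideal.Quotient.mk_mem_nonZeroDivisors {R : Type*} [CommRing R] {I : Ideal R} {x : R}
    (h : ∀ y, x * y ∈ I → y ∈ I) : Ideal.Quotient.mk I x ∈ nonZeroDivisors (R ⧸ I) := by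
  rw [mem_nonZeroDivisors_iff_right]
  intro z hz
  obtain ⟨y, rfl⟩ := Ideal.Quotient.mk_surjective z
  rw [← map_mul, Ideal.Quotient.eq_zero_iff_mem, mul_comm] at hz
  exact Ideal.Quotient.eq_zero_iff_mem.mpr (h y hz)

/-- If a constant `c` is regular in `R`, then it is regular modulo a variable of
`MvPolynomial σ R`. -/
theorem MvPolynomial.X_dvd_of_X_dvd_C_mul {σ R : Type*} [CommRing R] {c : R}
    (hc : c ∈ nonZeroDivisors R) {i : σ} {y : MvPolynomial σ R} (h : X i ∣ C c * y) :
    X i ∣ y := by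
  rw [X_dvd_iff_modMonomial_eq_zero] at h ⊢
  ext m
  have hm := congrArg (coeff m) h
  by_cases hle : Finsupp.single i 1 ≤ m
  · rw [coeff_modMonomial_of_le _ hle, coeff_zero]
  · rw [coeff_modMonomial_of_not_le _ hle, coeff_C_mul, coeff_zero] at hm
    rw [coeff_modMonomial_of_not_le _ hle, coeff_zero]
    exact (mul_left_mem_nonZeroDivisors_eq_zero_iff hc).mp hm

/-- A polynomial congruent to a regular constant modulo a variable can be cancelled against that
variable. -/
theorem MvPolynomial.dvd_of_dvd_X_mul {σ R : Type*} [CommRing R] {c : R}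
    (hc : c ∈ nonZeroDivisors R) {i : σ} {f g q : MvPolynomial σ R} (hf : f = C c + X i * g)
    (h : f ∣ X i * q) : f ∣ q := by
  obtain ⟨y, hy⟩ := h
  have hdvd : X i ∣ C c * y := ⟨q - g * y, by rw [mul_sub, hy, hf]; ring⟩
  obtain ⟨z, rfl⟩ := X_dvd_of_X_dvd_C_mul hc hdvd
  exact ⟨z, X_mul_cancel_left_iff.mp (by rw [hy]; ring)⟩

/-- The polynomial obtained from `s j k` by applying `d` times the substitution
`s j k = a j k + e * s (j + 1) k`. -/
noncomputable def expandS (a : ℕ → ℕ → L) (k : ℕ) : ℕ → ℕ → MvPolynomial Gen L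
  | 0, j => X (Gen.s j k)
  | d + 1, j => C (a j k) + X (Gen.s 0 0) * expandS a k d (j + 1)

/-- The image of the generator `s j k` under `expandGens a N`. -/
noncomputable def expandGenS (a : ℕ → ℕ → L) (N j : ℕ) : ℕ → MvPolynomial Gen L
  | 0 => if j = 0 then X (Gen.s 0 0) else if j = 1 then 1 else 0
  | k + 1 => expandS a (k + 1) (N - j) j

/-- The polynomial obtained from `t k` by applying `d` times the substitution
`t k = s 0 k + e * t (k + 1)`, each `s 0 k` being itself expanded. -/
noncomputable def expandT (a : ℕ → ℕ → L) (N : ℕ) : ℕ → ℕ → MvPolynomial Gen L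
  | 0, k => X (Gen.t k)
  | d + 1, k => expandGenS a N 0 k + X (Gen.s 0 0) * expandT a N d (k + 1)

/-- The image of the generator `t k` under `expandGens a N`. -/
noncomputable def expandGenT (a : ℕ → ℕ → L) (N : ℕ) : ℕ → MvPolynomial Gen L
  | 0 => 0
  | 1 => -1
  | k + 2 => expandT a N (N - (k + 2)) (k + 2)

/-- The endomorphism rewriting every generator of index less than `N` in terms of the generators
of index `N`, using the relations `rels L a` and `1 + t 1 = 0`. -/
noncomputable def expandGens (a : ℕ → ℕ → L) (N : ℕ) :
    MvPolynomial Gen L →ₐ[L] MvPolynomial Gen L :=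
  aeval fun
    | Gen.s j k => expandGenS a N j k
    | Gen.t k => expandGenT a N k

@[simp]
theorem expandGens_X_s (a : ℕ → ℕ → L) (N j k : ℕ) :
    expandGens a N (X (Gen.s j k)) = expandGenS a N j k := by
  simp [expandGens]

@[simp]
theorem expandGens_X_t (a : ℕ → ℕ → L) (N k : ℕ) :
    expandGens a N (X (Gen.t k)) = expandGenT a N k := by
  simp [expandGens]

@[simp]
theorem expandGens_C (a : ℕ → ℕ → L) (N : ℕ) (c : L) : expandGens a N (C c) = C c :=
  (expandGens a N).commutes c

/-- The ideal of polynomials mapping to zero in `R / (1 + t 1)`. -/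
noncomputable def relIdeal (a : ℕ → ℕ → L) : Ideal (MvPolynomial Gen L) :=
  Ideal.span (rels L a ∪ {1 + X (Gen.t 1)})

theorem mk_mk_eq_zero_iff (a : ℕ → ℕ → L) (p : MvPolynomial Gen L) :
    Ideal.Quotient.mk (Ideal.span {1 + tR a 1})
        (Ideal.Quotient.mk (Ideal.span (rels L a)) p) = 0 ↔ p ∈ relIdeal a := by
  have hspan : Ideal.span {1 + tR a 1} =
      (Ideal.span {1 + X (Gen.t 1)}).map (Ideal.Quotient.mk (Ideal.span (rels L a))) := by
    rw [Ideal.map_span, Set.image_singleton, map_add, map_one, tR]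
  rw [Ideal.Quotient.eq_zero_iff_mem, hspan, relIdeal, Ideal.span_union, ← Ideal.mem_comap,
    Ideal.comap_map_of_surjective _ Ideal.Quotient.mk_surjective, ← RingHom.ker_eq_comap_bot,
    Ideal.mk_ker, sup_comm]

section

variable (a : ℕ → ℕ → L)

theorem s_one_zero_sub_one_mem : X (Gen.s 1 0) - 1 ∈ relIdeal a :=
  Ideal.subset_span (by simp [rels])

theorem t_zero_mem : X (Gen.t 0) ∈ relIdeal a :=
  Ideal.subset_span (by simp [rels])

theorem one_add_t_one_mem : 1 + X (Gen.t 1) ∈ relIdeal a :=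
  Ideal.subset_span (by simp)

theorem s_zero_mem {i : ℕ} (hi : 1 < i) : X (Gen.s i 0) ∈ relIdeal a :=
  Ideal.subset_span (Or.inl (Or.inl (Or.inl (Or.inr ⟨i, hi, rfl⟩))))

theorem t_sub_mem (k : ℕ) :
    X (Gen.t k) - X (Gen.s 0 k) - X (Gen.s 0 0) * X (Gen.t (k + 1)) ∈ relIdeal a :=
  Ideal.subset_span (Or.inl (Or.inl (Or.inr ⟨k, rfl⟩)))

theorem s_sub_mem (j k : ℕ) :
    X (Gen.s j k) - C (a j k) - X (Gen.s 0 0) * X (Gen.s (j + 1) k) ∈ relIdeal a :=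
  Ideal.subset_span (Or.inl (Or.inr ⟨j, k, rfl⟩))

theorem X_s_sub_expandS_mem (k d j : ℕ) :
    X (Gen.s j k) - expandS a k d j ∈ relIdeal a := by
  induction d generalizing j with
  | zero => simp [expandS]
  | succ d ih =>
    have h := add_mem (s_sub_mem a j k) (Ideal.mul_mem_left _ (X (Gen.s 0 0)) (ih (j + 1)))
    convert h using 1
    rw [expandS]
    ring

theorem X_s_sub_expandGenS_mem (N j k : ℕ) :
    X (Gen.s j k) - expandGenS a N j k ∈ relIdeal a := by
  rcases k with _ | k
  · rcases j with _ | _ | j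
    · simp [expandGenS]
    · simpa [expandGenS] using s_one_zero_sub_one_mem a
    · simpa [expandGenS] using s_zero_mem a (i := j + 2) (by omega)
  · exact X_s_sub_expandS_mem a _ _ _

theorem X_t_sub_expandT_mem (N d k : ℕ) :
    X (Gen.t k) - expandT a N d k ∈ relIdeal a := by
  induction d generalizing k with
  | zero => simp [expandT]
  | succ d ih =>
    have h := add_mem (add_mem (t_sub_mem a k) (X_s_sub_expandGenS_mem a N 0 k))
      (Ideal.mul_mem_left _ (X (Gen.s 0 0)) (ih (k + 1)))
    convert h using 1
    rw [expandT]
    ring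

theorem X_t_sub_expandGenT_mem (N k : ℕ) :
    X (Gen.t k) - expandGenT a N k ∈ relIdeal a := by
  rcases k with _ | _ | k
  · simpa [expandGenT] using t_zero_mem a
  · simpa [expandGenT, add_comm] using one_add_t_one_mem a
  · exact X_t_sub_expandT_mem a _ _ _

theorem sub_expandGens_mem (N : ℕ) (p : MvPolynomial Gen L) :
    p - expandGens a N p ∈ relIdeal a := by
  have h : (Ideal.Quotient.mkₐ L (relIdeal a)).comp (expandGens a N) =
      Ideal.Quotient.mkₐ L (relIdeal a) := by
    ext i
    refine (Ideal.Quotient.eq.mpr ?_).symm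
    cases i with
    | s j k => simpa using X_s_sub_expandGenS_mem a N j k
    | t k => simpa using X_t_sub_expandGenT_mem a N k
  exact Ideal.Quotient.eq.mp (DFunLike.congr_fun h p).symm

/-- The relation `t 1 - s 0 1 = e * t 2`, the only one `expandGens` does not eventually kill. -/
noncomputable def tOneRel : MvPolynomial Gen L :=
  X (Gen.t 1) - X (Gen.s 0 1) - X (Gen.s 0 0) * X (Gen.t 2)

theorem expandGens_tOneRel_mem (N : ℕ) : expandGens a N tOneRel ∈ relIdeal a := by
  have h := sub_mem (t_sub_mem a 1) (sub_expandGens_mem a N tOneRel)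
  rwa [tOneRel, sub_sub_cancel] at h

variable {a}

theorem expandGens_tOneRel (h01 : a 0 1 = 1) {N : ℕ} (hN : 1 ≤ N) :
    ∃ g, expandGens a N tOneRel = C (-2) + X (Gen.s 0 0) * g := by
  obtain ⟨M, rfl⟩ := Nat.exists_eq_add_of_le' hN
  refine ⟨-expandS a 1 M 1 - expandGenT a (M + 1) 2, ?_⟩
  simp only [tOneRel, map_sub, map_mul, expandGens_X_s, expandGens_X_t, expandGenS, expandS,
    zero_add, Nat.sub_zero, h01, if_true, map_neg, C_1, map_ofNat]
  rw [show expandGenT a (M + 1) 1 = -1 from rfl]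
  ring

theorem expandGens_s_sub (hsym : ∀ i j, a i j = a j i) (h01 : a 0 1 = 1)
    (h0 : ∀ i, i ≠ 1 → a 0 i = 0) {N j : ℕ} (hj : j < N) (k : ℕ) :
    expandGens a N (X (Gen.s j k) - C (a j k) - X (Gen.s 0 0) * X (Gen.s (j + 1) k)) = 0 := by
  rcases k with _ | k
  · rcases j with _ | _ | j
    · simp [expandGenS, h0 0]
    · simp [expandGenS, hsym 1 0, h01]
    · simp [expandGenS, hsym (j + 2) 0, h0 (j + 2)]
  · obtain ⟨d, rfl⟩ := Nat.exists_eq_add_of_lt hj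
    simp [expandGenS, show j + d + 1 - j = d + 1 by omega,
      show j + d + 1 - (j + 1) = d by omega, expandS]

theorem expandGens_t_sub {N k : ℕ} (hk : k < N) (hk1 : k ≠ 1) :
    expandGens a N (X (Gen.t k) - X (Gen.s 0 k) - X (Gen.s 0 0) * X (Gen.t (k + 1))) = 0 := by
  rcases k with _ | _ | k
  · simp [expandGenS, expandGenT]
  · exact absurd rfl hk1
  · obtain ⟨d, rfl⟩ := Nat.exists_eq_add_of_lt hk
    simp only [map_sub, map_mul, expandGens_X_s, expandGens_X_t]
    simp only [expandGenT, show k + 2 + d + 1 - (k + 2) = d + 1 by omega,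
      show k + 2 + d + 1 - (k + 1 + 2) = d by omega, expandT]
    simp [expandGenS]

theorem tOneRel_dvd_expandGens (hsym : ∀ i j, a i j = a j i) (h01 : a 0 1 = 1)
    (h0 : ∀ i, i ≠ 1 → a 0 i = 0) {p : MvPolynomial Gen L} (hp : p ∈ relIdeal a) :
    ∀ᶠ N in Filter.atTop, expandGens a N tOneRel ∣ expandGens a N p := by
  induction hp using Submodule.span_induction with
  | mem p hp =>
    rcases hp with ((((rfl | rfl) | ⟨i, hi, rfl⟩) | ⟨k, rfl⟩) | ⟨j, k, rfl⟩) | rfl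
    · simp [expandGenT]
    · simp [expandGenS]
    · simp [expandGenS, show i ≠ 0 by omega, show i ≠ 1 by omega]
    · by_cases hk : k = 1
      · subst hk
        exact Filter.Eventually.of_forall fun N => dvd_rfl
      · filter_upwards [Filter.eventually_gt_atTop k] with N hN
        rw [expandGens_t_sub hN hk]
        exact dvd_zero _
    · filter_upwards [Filter.eventually_gt_atTop j] with N hN
      rw [expandGens_s_sub hsym h01 h0 hN]
      exact dvd_zero _
    · simp [expandGenT]
  | zero => simp
  | add p q _ _ hp hq =>
    filter_upwards [hp, hq] with N hp hq
    rw [map_add]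
    exact dvd_add hp hq
  | smul r p _ hp =>
    filter_upwards [hp] with N hp
    rw [smul_eq_mul, map_mul]
    exact hp.mul_left _

theorem mem_relIdeal_of_X_mul_mem (hsym : ∀ i j, a i j = a j i) (h01 : a 0 1 = 1)
    (h0 : ∀ i, i ≠ 1 → a 0 i = 0) (h2 : (2 : L) ∈ nonZeroDivisors L) {p : MvPolynomial Gen L}
    (hp : X (Gen.s 0 0) * p ∈ relIdeal a) : p ∈ relIdeal a := by
  obtain ⟨N, hdvd, hN⟩ :=
    ((tOneRel_dvd_expandGens hsym h01 h0 hp).and (Filter.eventually_ge_atTop 1)).exists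
  obtain ⟨g, hg⟩ := expandGens_tOneRel h01 hN
  have hX : expandGens a N (X (Gen.s 0 0)) = X (Gen.s 0 0) := by simp [expandGenS]
  rw [map_mul, hX] at hdvd
  have h2' : (-2 : L) ∈ nonZeroDivisors L :=
    neg_one_mul (2 : L) ▸ mul_mem isUnit_neg_one.mem_nonZeroDivisors h2
  have hmem : expandGens a N p ∈ relIdeal a :=
    Ideal.mem_of_dvd _ (dvd_of_dvd_X_mul h2' hg hdvd) (expandGens_tOneRel_mem a N)
  simpa using add_mem (sub_expandGens_mem a N p) hmem

end

/-- If `2` is a nonzerodivisor in `L`, then the image of `e` is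
a nonzerodivisor in `R̄ := R/(1 + t₁)`. -/
theorem stmt11 (a : ℕ → ℕ → L) (hsym : ∀ i j, a i j = a j i)
    (h01 : a 0 1 = 1) (h0 : ∀ i, i ≠ 1 → a 0 i = 0)
    (h2 : (2 : L) ∈ nonZeroDivisors L) :
    Ideal.Quotient.mk (Ideal.span {1 + tR a 1}) (eR a) ∈
      nonZeroDivisors (Rring L a ⧸ Ideal.span {1 + tR a 1}) := by
  refine Ideal.Quotient.mk_mem_nonZeroDivisors fun y hy => ?_
  obtain ⟨p, rfl⟩ := Ideal.Quotient.mk_surjective y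
  rw [← Ideal.Quotient.eq_zero_iff_mem, mk_mk_eq_zero_iff]
  refine mem_relIdeal_of_X_mul_mem hsym h01 h0 h2 ?_
  rwa [← mk_mk_eq_zero_iff, map_mul, Ideal.Quotient.eq_zero_iff_mem]
end

section
/- Assume in addition that 2 is a nonzerodivisor in L. Then the e-power torsion of R is exactly the principal ideal generated by 1 + t_1: {u ∈ R : e^k u = 0 for some k ≥ 1} = (1 + t_1). In particular, since (1 + t_1)e = 0, every element of R annihilated by some power of e is already annihilated by e itself. -/
open MvPolynomial

variable {L : Type} [CommRing L]

/-- If `e` is a nonzerodivisor modulo `J` and `r` is a nonzerodivisor modulo `J + (e)`, then `e` is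
a nonzerodivisor modulo `J + (r)`. -/
theorem mem_sup_span_singleton_of_mul_mem {A : Type*} [CommRing A] {J : Ideal A} {e r : A}
    (he : ∀ p, e * p ∈ J → p ∈ J)
    (hr : ∀ p, r * p ∈ J ⊔ Ideal.span {e} → p ∈ J ⊔ Ideal.span {e}) {p : A}
    (hp : e * p ∈ J ⊔ Ideal.span {r}) : p ∈ J ⊔ Ideal.span {r} := by
  obtain ⟨j, hj, x, hx, hjx⟩ := Submodule.mem_sup.1 hp
  obtain ⟨v, rfl⟩ := Ideal.mem_span_singleton'.1 hx
  have hv : r * v ∈ J ⊔ Ideal.span {e} := by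
    have hrv : r * v = -j + p * e := by linear_combination hjx
    rw [hrv]
    exact Submodule.add_mem_sup (neg_mem hj)
      (Ideal.mul_mem_left _ _ (Ideal.mem_span_singleton_self e))
  obtain ⟨j', hj', y, hy, rfl⟩ := Submodule.mem_sup.1 (hr v hv)
  obtain ⟨w, rfl⟩ := Ideal.mem_span_singleton'.1 hy
  have hpw : p - w * r ∈ J := by
    apply he
    have hsub : e * (p - w * r) = j + r * j' := by linear_combination -hjx
    rw [hsub]
    exact add_mem hj (Ideal.mul_mem_left _ _ hj')
  have hsum : p = (p - w * r) + w * r := by ring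
  rw [hsum]
  exact Submodule.add_mem_sup hpw (Ideal.mul_mem_left _ _ (Ideal.mem_span_singleton_self r))

section Elimination

variable {σ : Type*}

theorem eq_zero_of_X_sub_C_mul_eq_zero (i : σ) (c : L) {p : MvPolynomial σ L}
    (h : (X i - C c) * p = 0) : p = 0 := by
  classical
  let shift (d : L) : MvPolynomial σ L →ₐ[L] MvPolynomial σ L :=
    aeval fun g => if g = i then X g + C d else X g
  have hinv : (shift (-c)).comp (shift c) = AlgHom.id L _ := by
    ext1 g
    by_cases hg : g = i <;> simp [shift, hg, algHom_C]
  have hX : X i * shift c p = 0 := by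
    have := congrArg (shift c) h
    simpa [shift, algHom_C] using this
  have hp : shift c p = 0 := by
    simpa using hX
  have := congrArg (shift (-c)) hp
  rw [map_zero] at this
  rw [← this]
  exact (DFunLike.congr_fun hinv p).symm

/-- A perturbation by a multiple of `X o` of the linear polynomial `X g - c g`. -/
noncomputable def perturbedLinear (o : σ) (c : σ → L) (G : σ → MvPolynomial σ L) (g : σ) :
    MvPolynomial σ L :=
  X g - C (c g) - X o * G g

open Classical in
/-- The substitution `X o ↦ 0` and `X g ↦ c g` for `g ∈ T`. -/
noncomputable def specialize (o : σ) (c : σ → L) (T : Set σ) :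
    MvPolynomial σ L →ₐ[L] MvPolynomial σ L :=
  aeval fun g => if g = o then 0 else if g ∈ T then C (c g) else X g

theorem mem_span_perturbedLinear_sup_iff (o : σ) (c : σ → L) (G : σ → MvPolynomial σ L)
    {T : Set σ} (hT : o ∉ T) (p : MvPolynomial σ L) :
    p ∈ Ideal.span (perturbedLinear o c G '' T) ⊔ Ideal.span {X o} ↔ specialize o c T p = 0 := by
  set K := Ideal.span (perturbedLinear o c G '' T) ⊔ Ideal.span {X o} with hK
  have ho : (X o : MvPolynomial σ L) ∈ K :=
    Ideal.mem_sup_right (Ideal.mem_span_singleton_self _)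
  constructor
  · intro hp
    have hle : K ≤ RingHom.ker (specialize o c T) := by
      refine sup_le (Ideal.span_le.2 ?_) (Ideal.span_le.2 ?_)
      · rintro _ ⟨g, hg, rfl⟩
        have hgo : g ≠ o := fun h => hT (h ▸ hg)
        simp [RingHom.mem_ker, perturbedLinear, specialize, hgo, hg, algHom_C]
      · simp [RingHom.mem_ker, specialize]
    exact hle hp
  · intro hp
    have hcomp : (Ideal.Quotient.mkₐ L K).comp (specialize o c T) = Ideal.Quotient.mkₐ L K := by
      ext1 g
      simp only [AlgHom.comp_apply, Ideal.Quotient.mkₐ_eq_mk]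
      refine Ideal.Quotient.eq.2 ?_
      by_cases hgo : g = o
      · subst hgo
        simpa [specialize] using ho
      by_cases hg : g ∈ T
      · have hr : perturbedLinear o c G g ∈ K :=
          Ideal.mem_sup_left (Ideal.subset_span ⟨g, hg, rfl⟩)
        have hsub : C (c g) - X g = -(perturbedLinear o c G g + G g * X o) := by
          simp only [perturbedLinear]; ring
        simp only [specialize, aeval_X, hgo, hg, if_true, if_false]
        rw [hsub]
        exact neg_mem (add_mem hr (Ideal.mul_mem_left _ _ ho))
      · simp [specialize, hgo, hg]
    have := DFunLike.congr_fun hcomp p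
    rw [AlgHom.comp_apply, hp, map_zero] at this
    exact Ideal.Quotient.eq_zero_iff_mem.1 this.symm

theorem mem_span_perturbedLinear_of_X_mul_mem_finset (o : σ) (c : σ → L)
    (G : σ → MvPolynomial σ L) (S : Finset σ) (hS : o ∉ S) (p : MvPolynomial σ L)
    (hp : X o * p ∈ Ideal.span (perturbedLinear o c G '' S)) :
    p ∈ Ideal.span (perturbedLinear o c G '' S) := by
  classical
  induction S using Finset.induction_on generalizing p with
  | empty =>
    simpa using hp
  | insert i S hi ih =>
    have hoS : o ∉ S := fun h => hS (Finset.mem_insert_of_mem h)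
    have hio : i ≠ o := fun h => hS (h ▸ Finset.mem_insert_self i S)
    rw [Finset.coe_insert, Set.image_insert_eq, Ideal.span_insert, sup_comm] at hp ⊢
    refine mem_sup_span_singleton_of_mul_mem (ih hoS) (fun q hq => ?_) hp
    rw [mem_span_perturbedLinear_sup_iff o c G (by simpa using hoS)] at hq ⊢
    apply eq_zero_of_X_sub_C_mul_eq_zero i (c i)
    simpa [perturbedLinear, specialize, hio, hi, algHom_C] using hq

theorem mem_span_perturbedLinear_of_X_mul_mem (o : σ) (c : σ → L) (G : σ → MvPolynomial σ L)
    {T : Set σ} (hT : o ∉ T) (p : MvPolynomial σ L)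
    (hp : X o * p ∈ Ideal.span (perturbedLinear o c G '' T)) :
    p ∈ Ideal.span (perturbedLinear o c G '' T) := by
  classical
  obtain ⟨F, hF, hpF⟩ := Submodule.mem_span_finite_of_mem_span hp
  obtain ⟨S, hST, rfl⟩ := Finset.subset_set_image_iff.1 hF
  rw [Finset.coe_image] at hpF
  exact Ideal.span_mono (Set.image_mono hST)
    (mem_span_perturbedLinear_of_X_mul_mem_finset o c G S (fun h => hT (hST h)) p hpF)

end Elimination

/-- The values of the generators of `R` modulo `e`. -/
def genValue (a : ℕ → ℕ → L) : Gen → L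
  | .s j k => a j k
  | .t k => a 0 k

/-- The coefficient of `e` in the relation eliminating a generator of `R`. -/
noncomputable def genCorrection (L : Type) [CommRing L] : Gen → MvPolynomial Gen L
  | .s _ 0 => 0
  | .s j (k + 1) => X (.s (j + 1) (k + 1))
  | .t 0 => 0
  | .t (k + 1) => X (.s 1 (k + 1)) + X (.t (k + 2))

/-- The relations eliminating the generators of `R` other than `e`. -/
noncomputable def elimRel (a : ℕ → ℕ → L) : Gen → MvPolynomial Gen L :=
  perturbedLinear (.s 0 0) (genValue a) (genCorrection L)

theorem span_rels_sup_eq (a : ℕ → ℕ → L) (hsym : ∀ i j, a i j = a j i)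
    (h01 : a 0 1 = 1) (h0 : ∀ i, i ≠ 1 → a 0 i = 0) :
    Ideal.span (rels L a) ⊔ Ideal.span {1 + X (Gen.t 1)} =
      Ideal.span (elimRel a '' {Gen.s 0 0}ᶜ) ⊔ Ideal.span {1 + X (Gen.t 1)} := by
  have h00 : a 0 0 = 0 := h0 0 (by simp)
  have h10 : a 1 0 = 1 := by rw [hsym, h01]
  have hj0 : ∀ j, a (j + 2) 0 = 0 := fun j => by rw [hsym, h0 _ (by simp)]
  apply le_antisymm
  · refine sup_le (Ideal.span_le.2 ?_) le_sup_right
    set K := Ideal.span (elimRel a '' {Gen.s 0 0}ᶜ) ⊔ Ideal.span {1 + X (Gen.t 1)}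
    have hr : ∀ g, g ≠ Gen.s 0 0 → elimRel a g ∈ K := fun g hg =>
      Ideal.mem_sup_left (Ideal.subset_span ⟨g, hg, rfl⟩)
    have ht1 : 1 + X (Gen.t 1) ∈ K := Ideal.mem_sup_right (Ideal.mem_span_singleton_self _)
    have ht0 : X (Gen.t 0) ∈ K := by
      simpa [elimRel, perturbedLinear, genValue, genCorrection, h00] using hr (.t 0) (by simp)
    have hs10 : X (Gen.s 1 0) - 1 ∈ K := by
      simpa [elimRel, perturbedLinear, genValue, genCorrection, h10] using hr (.s 1 0) (by simp)
    have hs : ∀ i, X (Gen.s (i + 2) 0) ∈ K := fun i => by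
      simpa [elimRel, perturbedLinear, genValue, genCorrection, hj0] using
        hr (.s (i + 2) 0) (by simp)
    have hsr : ∀ j k, X (Gen.s j k) - C (a j k) - X (Gen.s 0 0) * X (Gen.s (j + 1) k) ∈ K := by
      rintro j (_ | k)
      · obtain _ | _ | j := j
        · convert Ideal.mul_mem_left K (-X (Gen.s 0 0)) hs10 using 1
          simp only [h00, map_zero]; ring
        · simpa [h10] using sub_mem hs10 (Ideal.mul_mem_left K (X (Gen.s 0 0)) (hs 0))
        · simpa [hj0] using sub_mem (hs j) (Ideal.mul_mem_left K (X (Gen.s 0 0)) (hs (j + 1)))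
      · exact hr (.s j (k + 1)) (by simp)
    rintro p ((((hp | hp) | ⟨i, hi, rfl⟩) | ⟨k, rfl⟩) | ⟨j, k, rfl⟩)
    · exact hp ▸ ht0
    · exact hp ▸ hs10
    · obtain ⟨i, rfl⟩ := Nat.exists_eq_add_of_le' hi
      exact hs i
    · obtain _ | k := k
      · have h := sub_mem ht0 (Ideal.mul_mem_left K (X (Gen.s 0 0)) ht1)
        rwa [mul_add, mul_one, ← sub_sub] at h
      · rw [SetLike.mem_coe]
        convert sub_mem (hr (.t (k + 1)) (by simp)) (hsr 0 (k + 1)) using 1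
        simp only [elimRel, perturbedLinear, genValue, genCorrection]
        ring
    · exact hsr j k
  · refine sup_le (Ideal.span_le.2 ?_) le_sup_right
    set K := Ideal.span (rels L a) ⊔ Ideal.span {1 + X (Gen.t 1)}
    have hr : ∀ p ∈ rels L a, p ∈ K := fun p hp => Ideal.mem_sup_left (Ideal.subset_span hp)
    have hsr : ∀ j k, X (Gen.s j k) - C (a j k) - X (Gen.s 0 0) * X (Gen.s (j + 1) k) ∈ K :=
      fun j k => hr _ (.inr ⟨j, k, rfl⟩)
    rintro _ ⟨(⟨j, _ | k⟩ | ⟨_ | k⟩), hg, rfl⟩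
    · obtain _ | _ | j := j
      · simp at hg
      · have := hr (X (Gen.s 1 0) - 1) (.inl (.inl (.inl (.inr rfl))))
        simpa [elimRel, perturbedLinear, genValue, genCorrection, h10] using this
      · have := hr (X (Gen.s (j + 2) 0)) (.inl (.inl (.inr ⟨j + 2, by omega, rfl⟩)))
        simpa [elimRel, perturbedLinear, genValue, genCorrection, hj0] using this
    · exact hsr j (k + 1)
    · have := hr (X (Gen.t 0)) (.inl (.inl (.inl (.inl rfl))))
      simpa [elimRel, perturbedLinear, genValue, genCorrection, h00] using this
    · have := hr _ (.inl (.inr ⟨k + 1, rfl⟩))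
      rw [SetLike.mem_coe]
      convert add_mem this (hsr 0 (k + 1)) using 1
      simp only [elimRel, perturbedLinear, genValue, genCorrection]
      ring

/-- If `2` is a nonzerodivisor in `L`, then `e` is a nonzerodivisor in `R / (1 + t₁)`. -/
theorem mem_span_rels_sup_of_mul_mem (a : ℕ → ℕ → L) (hsym : ∀ i j, a i j = a j i)
    (h01 : a 0 1 = 1) (h0 : ∀ i, i ≠ 1 → a 0 i = 0) (h2 : (2 : L) ∈ nonZeroDivisors L)
    (p : MvPolynomial Gen L)
    (hp : X (Gen.s 0 0) * p ∈ Ideal.span (rels L a) ⊔ Ideal.span {1 + X (Gen.t 1)}) :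
    p ∈ Ideal.span (rels L a) ⊔ Ideal.span {1 + X (Gen.t 1)} := by
  rw [span_rels_sup_eq a hsym h01 h0] at hp ⊢
  refine mem_sup_span_singleton_of_mul_mem
    (mem_span_perturbedLinear_of_X_mul_mem _ _ _ (by simp)) (fun q hq => ?_) hp
  rw [mem_span_perturbedLinear_sup_iff _ _ _ (by simp)] at hq ⊢
  have hval : specialize (Gen.s 0 0) (genValue a) {Gen.s 0 0}ᶜ (1 + X (Gen.t 1)) = C 2 := by
    simp [specialize, genValue, h01, one_add_one_eq_two,
      show (C 2 : MvPolynomial Gen L) = 2 from map_ofNat C 2]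
  rw [map_mul, hval] at hq
  ext m
  have hm := congrArg (coeff m) hq
  rw [coeff_C_mul, coeff_zero, mul_comm] at hm
  exact (mem_nonZeroDivisors_iff_right.1 h2) _ hm

theorem one_add_tR_one_mul_eR (a : ℕ → ℕ → L) : (1 + tR a 1) * eR a = 0 := by
  have h1 : X (Gen.t 0) ∈ Ideal.span (rels L a) :=
    Ideal.subset_span (.inl (.inl (.inl (.inl rfl))))
  have h2 : X (Gen.t 0) - X (Gen.s 0 0) - X (Gen.s 0 0) * X (Gen.t 1) ∈ Ideal.span (rels L a) :=
    Ideal.subset_span (.inl (.inr ⟨0, rfl⟩))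
  change Ideal.Quotient.mk (Ideal.span (rels L a)) ((1 + X (Gen.t 1)) * X (Gen.s 0 0)) = 0
  rw [Ideal.Quotient.eq_zero_iff_mem]
  convert sub_mem h1 h2 using 1
  ring

/-- If `2` is a nonzerodivisor in `L`, then the `e`-power
torsion of `R` is exactly the principal ideal `(1 + t₁)`; moreover
`(1 + t₁) e = 0`, so anything killed by a power of `e` is killed by `e`. -/
theorem stmt12 (a : ℕ → ℕ → L) (hsym : ∀ i j, a i j = a j i)
    (h01 : a 0 1 = 1) (h0 : ∀ i, i ≠ 1 → a 0 i = 0)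
    (h2 : (2 : L) ∈ nonZeroDivisors L) :
    (∀ u : Rring L a,
      (∃ k : ℕ, 1 ≤ k ∧ eR a ^ k * u = 0) ↔ u ∈ Ideal.span {1 + tR a 1}) ∧
    (1 + tR a 1) * eR a = 0 ∧
    (∀ u : Rring L a, (∃ k : ℕ, 1 ≤ k ∧ eR a ^ k * u = 0) → eR a * u = 0) := by
  have hann : ∀ u : Rring L a, u ∈ Ideal.span {1 + tR a 1} → eR a * u = 0 := by
    intro u hu
    obtain ⟨v, rfl⟩ := Ideal.mem_span_singleton'.1 hu
    linear_combination v * one_add_tR_one_mul_eR a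
  have htors : ∀ u : Rring L a, (∃ k : ℕ, 1 ≤ k ∧ eR a ^ k * u = 0) →
      u ∈ Ideal.span {1 + tR a 1} := by
    rintro u ⟨k, -, hk⟩
    obtain ⟨p, rfl⟩ := Ideal.Quotient.mk_surjective u
    have hp : X (Gen.s 0 0) ^ k * p ∈
        Ideal.span (rels L a) ⊔ Ideal.span {1 + X (Gen.t 1)} :=
      Ideal.mem_sup_left (Ideal.Quotient.eq_zero_iff_mem.1 hk)
    have hp' : p ∈ Ideal.span (rels L a) ⊔ Ideal.span {1 + X (Gen.t 1)} := by
      clear hk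
      induction k with
      | zero => simpa using hp
      | succ k ih =>
        rw [pow_succ', mul_assoc] at hp
        exact ih (mem_span_rels_sup_of_mul_mem a hsym h01 h0 h2 _ hp)
    obtain ⟨x, hx, y, hy, rfl⟩ := Submodule.mem_sup.1 hp'
    obtain ⟨v, rfl⟩ := Ideal.mem_span_singleton'.1 hy
    rw [map_add, Ideal.Quotient.eq_zero_iff_mem.2 hx, zero_add, map_mul]
    exact Ideal.mul_mem_left _ _ (Ideal.mem_span_singleton_self _)
  exact ⟨fun u => ⟨htors u, fun hu => ⟨1, le_rfl, by rw [pow_one, hann u hu]⟩⟩,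
    one_add_tR_one_mul_eR a, fun u hu => hann u (htors u hu)⟩
end
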